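/- Let a > 0, α ∈ [0,1) and δ ∈ (0,1) with 1/(2δ) not an integer. For μ ≥ 0 define, for complex s with Re s > 1/(2δ), ζ⁶_μ(s) = −(sin(πs)/π) · (4μ+1)^{−s} · ∑_{k ∈ ℤ, k ≠ 0} (|k|^{2δ} − 1/4)^{−s} · log(√(4π²(k+α)²a² + 1/4 + μ) + √(4π²(k−α)²a² + 1/4 + μ)) (the series converges for Re s > 1/(2δ)). Then there exists μ₀ ≥ 0 such that for every μ ≥ μ₀ the function ζ⁶_μ extends to a holomorphic function g_μ on a connected open subset of ℂ containing 0 and the half-plane Re s > 1/(2δ), with g_μ(0) = 0; moreover g_μ'(0) = (1/2)·log μ − √μ/(2a) + log 2 + o(1) as μ → +∞. -/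

import Mathlib

open Real Complex Filter

/-- The `k`-th term of the series defining `ζ⁶_μ(s)` from the sixth part of the
study of the terms `A_{μ,k}`:
`-(sin(πs)/π)(4μ+1)^{-s} (|k|^{2δ}-1/4)^{-s}
  log(√(4π²(k+α)²a²+1/4+μ) + √(4π²(k-α)²a²+1/4+μ))`. -/
noncomputable def zeta6Term (a α δ μ : ℝ) (k : {k : ℤ // k ≠ 0}) (s : ℂ) : ℂ :=
  -(Complex.sin (π * s) / π) * ((4 * μ + 1 : ℝ) : ℂ) ^ (-s) *
    ((|((k : ℤ) : ℝ)| ^ (2 * δ) - 1 / 4 : ℝ) : ℂ) ^ (-s) *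
    ((Real.log (Real.sqrt (4 * π ^ 2 * (((k : ℤ) : ℝ) + α) ^ 2 * a ^ 2 + 1 / 4 + μ) +
        Real.sqrt (4 * π ^ 2 * (((k : ℤ) : ℝ) - α) ^ 2 * a ^ 2 + 1 / 4 + μ)) : ℝ) : ℂ)

/-- The coefficient of `w ^ j` in the binomial expansion of `(1 - w / 4) ^ (-s)`. -/
noncomputable def quarterBinomCoeff : ℕ → ℂ → ℂ
  | 0, _ => 1
  | j + 1, s => s / 4 * quarterBinomCoeff j (s + 1) / (j + 1)

/-- The remainder of order `N` of the binomial expansion of `(1 - w / 4) ^ (-s)`. -/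
noncomputable def quarterBinomRem (N : ℕ) (s : ℂ) (w : ℝ) : ℂ :=
  ((1 - w / 4 : ℝ) : ℂ) ^ (-s) - ∑ j ∈ Finset.range N, quarterBinomCoeff j s * (w : ℂ) ^ j

lemma differentiable_quarterBinomCoeff (j : ℕ) : Differentiable ℂ (quarterBinomCoeff j) := by
  induction j with
  | zero => exact differentiable_const _
  | succ j ih =>
    change Differentiable ℂ fun s => s / 4 * quarterBinomCoeff j (s + 1) / (j + 1)
    fun_prop

lemma differentiable_quarterBinomRem (N : ℕ) {w : ℝ} (hw : w < 4) :
    Differentiable ℂ (fun s => quarterBinomRem N s w) := by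
  have h : ((1 - w / 4 : ℝ) : ℂ) ≠ 0 := by
    rw [Ne, Complex.ofReal_eq_zero]; linarith
  have := fun j => differentiable_quarterBinomCoeff j
  unfold quarterBinomRem
  refine Differentiable.sub (fun s => ?_) (by fun_prop)
  exact (differentiableAt_id.neg).const_cpow (Or.inl h)

lemma hasDerivAt_quarterBinomRem (N : ℕ) (s : ℂ) {w : ℝ} (hw : w < 4) :
    HasDerivAt (quarterBinomRem (N + 1) s) (s / 4 * quarterBinomRem N (s + 1) w) w := by
  have h : (0 : ℝ) < 1 - w / 4 := by linarith
  have h1 : HasDerivAt (fun z : ℂ => 1 - z / 4) (-(1 / 4)) (w : ℂ) := by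
    simpa using ((hasDerivAt_id (w : ℂ)).div_const 4).const_sub 1
  have h2 := (h1.cpow_const (c := -s) (Or.inl (by
    rw [show (1 - (w : ℂ) / 4) = ((1 - w / 4 : ℝ) : ℂ) by push_cast; rfl]
    exact h))).comp_ofReal
  have h3 : HasDerivAt (fun w : ℝ => ∑ j ∈ Finset.range (N + 1), quarterBinomCoeff j s * (w : ℂ) ^ j)
      (s / 4 * ∑ j ∈ Finset.range N, quarterBinomCoeff j (s + 1) * (w : ℂ) ^ j) w := by
    have : ∀ j ∈ Finset.range (N + 1), HasDerivAt (fun w : ℝ => quarterBinomCoeff j s * (w : ℂ) ^ j)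
        (quarterBinomCoeff j s * (j * (w : ℂ) ^ (j - 1))) w := by
      intro j _
      exact ((hasDerivAt_pow j (w : ℂ)).comp_ofReal).const_mul _
    refine (HasDerivAt.fun_sum this).congr_deriv ?_
    rw [Finset.sum_range_succ', Finset.mul_sum]
    simp only [Nat.cast_zero, zero_mul, mul_zero, add_zero, Nat.add_sub_cancel, quarterBinomCoeff]
    refine Finset.sum_congr rfl fun j _ => ?_
    have : (j : ℂ) + 1 ≠ 0 := by exact_mod_cast Nat.succ_ne_zero j
    push_cast
    field_simp
  have hf : quarterBinomRem (N + 1) s = fun w : ℝ => (1 - (w : ℂ) / 4) ^ (-s) -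
      ∑ j ∈ Finset.range (N + 1), quarterBinomCoeff j s * (w : ℂ) ^ j := by
    ext x
    simp [quarterBinomRem]
  rw [hf]
  refine (h2.fun_sub h3).congr_deriv ?_
  rw [quarterBinomRem, neg_add, ← sub_eq_add_neg]
  push_cast
  ring_nf

lemma exists_norm_quarterBinomRem_le (N : ℕ) :
    ∀ R : ℝ, ∃ C : ℝ, 0 ≤ C ∧ ∀ s : ℂ, ‖s‖ ≤ R → ∀ w : ℝ, 0 ≤ w → w ≤ 1 →
      ‖quarterBinomRem N s w‖ ≤ C * w ^ N := by
  induction N with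
  | zero =>
    intro R
    refine ⟨(3 / 4 : ℝ) ^ (-R), by positivity, fun s hs w hw0 hw1 => ?_⟩
    have h : (0 : ℝ) < 1 - w / 4 := by linarith
    simp only [quarterBinomRem, Finset.range_zero, Finset.sum_empty, sub_zero, pow_zero, mul_one]
    rw [Complex.norm_cpow_eq_rpow_re_of_pos h, neg_re]
    calc (1 - w / 4) ^ (-s.re) ≤ (1 - w / 4) ^ (-R) :=
          Real.rpow_le_rpow_of_exponent_ge h (by linarith)
            (neg_le_neg ((Complex.re_le_norm s).trans hs))
      _ ≤ (3 / 4 : ℝ) ^ (-R) :=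
          Real.rpow_le_rpow_of_nonpos (by norm_num) (by linarith)
            (by linarith [norm_nonneg s])
  | succ N ih =>
    intro R
    obtain ⟨C, hC, h⟩ := ih (R + 1)
    refine ⟨|R| / 4 * C, by positivity, fun s hs w hw0 hw1 => ?_⟩
    have hb : ∀ t ∈ Set.Ico 0 w, ‖s / 4 * quarterBinomRem N (s + 1) t‖ ≤ |R| / 4 * (C * w ^ N) := by
      intro t ht
      rw [norm_mul, norm_div]
      have h1 : ‖s + 1‖ ≤ R + 1 := (norm_add_le _ _).trans (by simpa using hs)
      have h2 := h (s + 1) h1 t ht.1 (ht.2.le.trans hw1)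
      have h3 : t ^ N ≤ w ^ N := pow_le_pow_left₀ ht.1 ht.2.le N
      have h4 : ‖(4 : ℂ)‖ = 4 := by simp
      rw [h4]
      have h5 := hs.trans (le_abs_self R)
      refine mul_le_mul (by linarith) (h2.trans (by gcongr)) (norm_nonneg _) (by positivity)
    have key := norm_image_sub_le_of_norm_deriv_le_segment' (f := quarterBinomRem (N + 1) s)
      (fun t ht => (hasDerivAt_quarterBinomRem N s (by linarith [ht.2] : t < 4)).hasDerivWithinAt)
      hb w ⟨hw0, le_rfl⟩
    have h0 : quarterBinomRem (N + 1) s 0 = 0 := by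
      simp [quarterBinomRem, Finset.sum_range_succ', quarterBinomCoeff]
    rw [h0, sub_zero, sub_zero] at key
    refine key.trans (le_of_eq ?_)
    ring

lemma quarterBinomRem_zero_right {N : ℕ} (hN : N ≠ 0) (w : ℝ) : quarterBinomRem N 0 w = 0 := by
  obtain ⟨N, rfl⟩ := Nat.exists_eq_succ_of_ne_zero hN
  simp [quarterBinomRem, Finset.sum_range_succ', quarterBinomCoeff]

/-- The Dirichlet-type series with coefficients `b` attached to the binomial remainders converges
to a holomorphic function on `Re s > -1/2`. -/
lemma summable_and_differentiableOn_tsum_quarterBinomRem {δ : ℝ} (hδ : 0 < δ) (N : ℕ) {b : ℕ → ℂ}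
    (hb : Summable fun n : ℕ => ((n + 1 : ℝ)) ^ (δ - 2 * δ * N) * ‖b n‖) :
    (∀ s : ℂ, -1 / 2 < s.re → Summable fun n : ℕ => ((n + 1 : ℝ) : ℂ) ^ (-(2 * δ * s)) *
        quarterBinomRem N s ((n + 1 : ℝ) ^ (-(2 * δ))) * b n) ∧
    DifferentiableOn ℂ (fun s : ℂ => ∑' n : ℕ, ((n + 1 : ℝ) : ℂ) ^ (-(2 * δ * s)) *
        quarterBinomRem N s ((n + 1 : ℝ) ^ (-(2 * δ))) * b n) {s : ℂ | -1 / 2 < s.re} := by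
  have hw1 : ∀ n : ℕ, (n + 1 : ℝ) ^ (-(2 * δ)) ≤ 1 := fun n =>
    Real.rpow_le_one_of_one_le_of_nonpos (by linarith [n.cast_nonneg (α := ℝ)]) (by linarith)
  have bound : ∀ R : ℝ, ∃ C : ℝ, ∀ n : ℕ, ∀ s : ℂ, s ∈ {s : ℂ | -1 / 2 < s.re} ∩ Metric.ball 0 R →
      ‖((n + 1 : ℝ) : ℂ) ^ (-(2 * δ * s)) *
        quarterBinomRem N s ((n + 1 : ℝ) ^ (-(2 * δ))) * b n‖ ≤
      C * ((n + 1 : ℝ) ^ (δ - 2 * δ * N) * ‖b n‖) := by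
    intro R
    obtain ⟨C, hC, h⟩ := exists_norm_quarterBinomRem_le N R
    refine ⟨C, fun n s hs => ?_⟩
    have hn : (0 : ℝ) < n + 1 := by positivity
    have hs1 : -1 / 2 < s.re := hs.1
    have hs2 : ‖s‖ ≤ R := by simpa using (Metric.mem_ball.1 hs.2).le
    have h1 := h s hs2 ((n + 1 : ℝ) ^ (-(2 * δ))) (by positivity) (hw1 n)
    have h2 : ‖((n + 1 : ℝ) : ℂ) ^ (-(2 * δ * s))‖ ≤ (n + 1 : ℝ) ^ δ := by
      rw [Complex.norm_cpow_eq_rpow_re_of_pos hn]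
      refine Real.rpow_le_rpow_of_exponent_le (by linarith [n.cast_nonneg (α := ℝ)]) ?_
      have : (-(2 * δ * s)).re = -(2 * δ * s.re) := by simp
      rw [this]; nlinarith
    rw [norm_mul, norm_mul]
    calc _ ≤ (n + 1 : ℝ) ^ δ * (C * ((n + 1 : ℝ) ^ (-(2 * δ))) ^ N) * ‖b n‖ := by gcongr
      _ = _ := by
        rw [← Real.rpow_mul_natCast hn.le, sub_eq_add_neg, Real.rpow_add hn, ← neg_mul]
        ring_nf
  constructor
  · intro s hs
    obtain ⟨C, hC⟩ := bound (‖s‖ + 1)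
    exact Summable.of_norm_bounded (hb.mul_left C) fun n => hC n s ⟨hs, by simp⟩
  · intro s hs
    obtain ⟨C, hC⟩ := bound (‖s‖ + 1)
    have ho : IsOpen ({s : ℂ | -1 / 2 < s.re} ∩ Metric.ball 0 (‖s‖ + 1)) :=
      (isOpen_lt continuous_const Complex.continuous_re).inter Metric.isOpen_ball
    refine ((differentiableOn_tsum_of_summable_norm (hb.mul_left C) (fun n => ?_) ho
      hC).differentiableAt (ho.mem_nhds ⟨hs, by simp⟩)).differentiableWithinAt
    have hn : ((n + 1 : ℝ) : ℂ) ≠ 0 := by exact_mod_cast n.succ_ne_zero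
    refine Differentiable.differentiableOn ?_
    refine (Differentiable.mul (fun z => ?_)
      (differentiable_quarterBinomRem N ((hw1 n).trans_lt (by norm_num)))).mul_const _
    exact DifferentiableAt.const_cpow (by fun_prop) (Or.inl hn)

lemma summable_rpow_mul_log_add {σ : ℝ} (hσ : σ < -1) (c : ℝ) :
    Summable fun n : ℕ => (n + 1 : ℝ) ^ σ * |Real.log (n + 1) + c| := by
  set ε : ℝ := (-1 - σ) / 2 with hε
  have hε0 : 0 < ε := by linarith
  have hs : Summable fun n : ℕ => (n + 1 : ℝ) ^ (σ + ε) := by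
    have := (Real.summable_nat_rpow (p := σ + ε)).2 (by linarith)
    simpa using (summable_nat_add_iff 1).2 this
  refine Summable.of_nonneg_of_le (fun n => by positivity) (fun n => ?_)
    (hs.mul_left (1 / ε + |c|))
  have hn : (1 : ℝ) ≤ n + 1 := by linarith [n.cast_nonneg (α := ℝ)]
  have hn0 : (0 : ℝ) < n + 1 := by linarith
  have h1 : Real.log (n + 1) ≤ (n + 1 : ℝ) ^ ε / ε := Real.log_le_rpow_div hn0.le hε0
  have h2 : 1 ≤ (n + 1 : ℝ) ^ ε := Real.one_le_rpow hn hε0.le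
  have h3 : |Real.log (n + 1) + c| ≤ (1 / ε + |c|) * (n + 1 : ℝ) ^ ε := by
    refine (abs_add_le _ _).trans ?_
    rw [abs_of_nonneg (Real.log_nonneg hn), add_mul]
    refine add_le_add (h1.trans_eq (by ring)) (le_mul_of_one_le_right (abs_nonneg c) h2)
  calc _ ≤ (n + 1 : ℝ) ^ σ * ((1 / ε + |c|) * (n + 1 : ℝ) ^ ε) := by gcongr
    _ = _ := by rw [Real.rpow_add hn0]; ring

lemma hasSum_cpow_riemannZeta {z : ℂ} (hz : 1 < z.re) :
    HasSum (fun n : ℕ => ((n + 1 : ℝ) : ℂ) ^ (-z)) (riemannZeta z) := by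
  have h := LSeriesHasSum_one hz
  rw [LSeriesHasSum, ← hasSum_nat_add_iff' 1] at h
  simpa [LSeries.term_def, Complex.cpow_neg] using h

lemma hasSum_cpow_mul_log {z : ℂ} (hz : 1 < z.re) :
    HasSum (fun n : ℕ => ((n + 1 : ℝ) : ℂ) ^ (-z) * (Real.log (n + 1) : ℝ))
      (-deriv riemannZeta z) := by
  have ha : LSeries.abscissaOfAbsConv 1 < z.re := by
    rw [LSeries.abscissaOfAbsConv_one]; exact_mod_cast hz
  have hd : deriv riemannZeta z = -LSeries (LSeries.logMul 1) z := by
    rw [← LSeries_deriv ha]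
    refine Filter.EventuallyEq.deriv_eq ?_
    filter_upwards [(isOpen_lt continuous_const Complex.continuous_re).mem_nhds hz] with w hw
    exact (LSeries_one_eq_riemannZeta hw).symm
  have h := (LSeriesSummable_logMul_of_lt_re ha).LSeriesHasSum
  rw [LSeriesHasSum, ← hasSum_nat_add_iff' 1] at h
  rw [hd, neg_neg]
  simpa [LSeries.term_def, Complex.cpow_neg, LSeries.logMul, div_eq_inv_mul, Complex.ofReal_log,
    add_nonneg] using h

lemma rpow_sub_quarter_cpow {x δ : ℝ} (hx : 1 ≤ x) (hδ : 0 < δ) (s : ℂ) :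
    ((x ^ (2 * δ) - 1 / 4 : ℝ) : ℂ) ^ (-s) =
      (x : ℂ) ^ (-(2 * δ * s)) * ((1 - x ^ (-(2 * δ)) / 4 : ℝ) : ℂ) ^ (-s) := by
  have hx0 : 0 < x := by linarith
  have h1 : x ^ (-(2 * δ)) ≤ 1 := Real.rpow_le_one_of_one_le_of_nonpos hx (by linarith)
  have h2 : x ^ (2 * δ) - 1 / 4 = x ^ (2 * δ) * (1 - x ^ (-(2 * δ)) / 4) := by
    have : x ^ (2 * δ) * x ^ (-(2 * δ)) = 1 := by rw [← Real.rpow_add hx0]; simp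
    linear_combination this / 4
  rw [h2, Complex.ofReal_mul, Complex.mul_cpow_ofReal_nonneg (by positivity) (by linarith)]
  congr 1
  rw [Complex.cpow_def_of_ne_zero (by exact_mod_cast (Real.rpow_pos_of_pos hx0 _).ne'),
    Complex.cpow_def_of_ne_zero (by exact_mod_cast hx0.ne'), ← Complex.ofReal_log hx0.le,
    ← Complex.ofReal_log (by positivity), Real.log_rpow hx0]
  congr 1
  push_cast
  ring

lemma cpow_mul_rpow_pow {x δ : ℝ} (hx : 0 < x) (s : ℂ) (j : ℕ) :
    (x : ℂ) ^ (-(2 * δ * s)) * ((x ^ (-(2 * δ)) : ℝ) : ℂ) ^ j = (x : ℂ) ^ (-(2 * δ * (s + j))) := by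
  rw [Complex.ofReal_cpow hx.le, ← Complex.cpow_mul_nat, ← Complex.cpow_add _ _
    (by exact_mod_cast hx.ne')]
  congr 1
  push_cast
  ring

lemma differentiableAt_deriv_riemannZeta {z : ℂ} (hz : z ≠ 1) :
    DifferentiableAt ℂ (deriv riemannZeta) z := by
  have h : DifferentiableOn ℂ riemannZeta {1}ᶜ := fun w hw =>
    (differentiableAt_riemannZeta hw).differentiableWithinAt
  exact (h.deriv isOpen_compl_singleton).differentiableAt (isOpen_compl_singleton.mem_nhds hz)

/-- Continuation of `∑ (n ^ (2δ) - 1/4) ^ (-s) * (log n + c + e n)`, with `e n = O(n⁻²)`, to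
`Re s > -1/2` away from the poles, and its value at `0`. -/
theorem exists_continuation {δ : ℝ} (hδ0 : 0 < δ) (hδ1 : δ < 1) (c : ℝ) {e : ℕ → ℝ} {C : ℝ}
    (he : ∀ n : ℕ, |e n| ≤ C * (n + 1 : ℝ) ^ (-2 : ℝ)) :
    ∃ G : ℂ → ℂ,
      (∀ s : ℂ, -1 / 2 < s.re → (∀ j : ℕ, 2 * δ * (s + j) ≠ 1) → DifferentiableAt ℂ G s) ∧
      (∀ s : ℂ, 1 / (2 * δ) < s.re →
        HasSum (fun n : ℕ => (((n + 1 : ℝ) ^ (2 * δ) - 1 / 4 : ℝ) : ℂ) ^ (-s) *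
          ((Real.log (n + 1) + c + e n : ℝ) : ℂ)) (G s)) ∧
      G 0 = ((Real.log (2 * π) / 2 - c / 2 + ∑' n, e n : ℝ) : ℂ) := by
  obtain ⟨N, hN0, hN⟩ : ∃ N : ℕ, N ≠ 0 ∧ δ - 2 * δ * N < -1 := by
    obtain ⟨N, hN⟩ := exists_nat_gt ((1 + δ) / (2 * δ))
    rw [div_lt_iff₀ (by positivity)] at hN
    refine ⟨N, ?_, by linarith⟩
    rintro rfl
    simp at hN
    linarith
  have hb1 : Summable fun n : ℕ => ((n + 1 : ℝ)) ^ (δ - 2 * δ * N) *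
      ‖((Real.log (n + 1) + c : ℝ) : ℂ)‖ := by
    simpa only [Complex.norm_real, Real.norm_eq_abs] using summable_rpow_mul_log_add hN c
  have hb2 : Summable fun n : ℕ => ((n + 1 : ℝ)) ^ (δ - 2 * δ * (0 : ℕ)) * ‖(e n : ℂ)‖ := by
    have hs : Summable fun n : ℕ => (n + 1 : ℝ) ^ (δ - 2) := by
      have := (Real.summable_nat_rpow (p := δ - 2)).2 (by linarith)
      simpa using (summable_nat_add_iff 1).2 this
    refine Summable.of_nonneg_of_le (fun n => by positivity) (fun n => ?_) (hs.mul_left C)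
    have hn : (0 : ℝ) < n + 1 := by positivity
    rw [Complex.norm_real, Real.norm_eq_abs]
    calc _ ≤ (n + 1 : ℝ) ^ (δ - 2 * δ * (0 : ℕ)) * (C * (n + 1 : ℝ) ^ (-2 : ℝ)) := by
          gcongr; exact he n
      _ = _ := by
          rw [sub_eq_add_neg δ 2, Real.rpow_add hn]
          simp; ring
  obtain ⟨hS1, hD1⟩ := summable_and_differentiableOn_tsum_quarterBinomRem hδ0 N hb1
  obtain ⟨hS2, hD2⟩ := summable_and_differentiableOn_tsum_quarterBinomRem hδ0 0 hb2
  have ho : IsOpen {s : ℂ | -1 / 2 < s.re} := isOpen_lt continuous_const Complex.continuous_re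
  refine ⟨fun s => ∑ j ∈ Finset.range N, quarterBinomCoeff j s *
      (-deriv riemannZeta (2 * δ * (s + j)) + riemannZeta (2 * δ * (s + j)) * c) +
      (∑' n : ℕ, ((n + 1 : ℝ) : ℂ) ^ (-(2 * δ * s)) *
        quarterBinomRem N s ((n + 1 : ℝ) ^ (-(2 * δ))) * ((Real.log (n + 1) + c : ℝ) : ℂ)) +
      ∑' n : ℕ, ((n + 1 : ℝ) : ℂ) ^ (-(2 * δ * s)) *
        quarterBinomRem 0 s ((n + 1 : ℝ) ^ (-(2 * δ))) * (e n : ℂ), ?_, ?_, ?_⟩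
  · intro s hs hj
    refine DifferentiableAt.add (DifferentiableAt.add ?_ (hD1.differentiableAt (ho.mem_nhds hs)))
      (hD2.differentiableAt (ho.mem_nhds hs))
    refine DifferentiableAt.fun_sum fun j _ => ?_
    refine (differentiable_quarterBinomCoeff j s).mul (DifferentiableAt.add ?_ ?_)
    · exact (DifferentiableAt.comp s (g := deriv riemannZeta)
        (differentiableAt_deriv_riemannZeta (hj j)) (by fun_prop)).neg
    · exact (DifferentiableAt.comp s (g := riemannZeta)
        (differentiableAt_riemannZeta (hj j)) (by fun_prop)).mul_const _
  · intro s hs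
    have hs' : 1 < 2 * δ * s.re := by
      rw [div_lt_iff₀ (by positivity)] at hs; linarith
    have hs2 : -1 / 2 < s.re := by
      have : 0 < 1 / (2 * δ) := by positivity
      linarith
    have hz : ∀ j ∈ Finset.range N, HasSum (fun n : ℕ => quarterBinomCoeff j s *
        (((n + 1 : ℝ) : ℂ) ^ (-(2 * δ * (s + j))) * (Real.log (n + 1) : ℝ) +
          ((n + 1 : ℝ) : ℂ) ^ (-(2 * δ * (s + j))) * c))
        (quarterBinomCoeff j s *
      (-deriv riemannZeta (2 * δ * (s + j)) + riemannZeta (2 * δ * (s + j)) * c)) := by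
      intro j _
      have h : 1 < (2 * δ * (s + j)).re := by
        have : (2 * δ * (s + j)).re = 2 * δ * s.re + 2 * δ * j := by simp; ring
        rw [this]
        have : 0 ≤ 2 * δ * j := by positivity
        linarith
      exact ((hasSum_cpow_mul_log h).add ((hasSum_cpow_riemannZeta h).mul_right _)).mul_left _
    refine (((hasSum_sum hz).add (hS1 s hs2).hasSum).add (hS2 s hs2).hasSum).congr_fun fun n => ?_
    have hn0 : (0 : ℝ) < n + 1 := by positivity
    have hn : (1 : ℝ) ≤ n + 1 := by linarith [n.cast_nonneg (α := ℝ)]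
    rw [rpow_sub_quarter_cpow hn hδ0]
    simp only [← cpow_mul_rpow_pow hn0, quarterBinomRem, Finset.range_zero, Finset.sum_empty,
      sub_zero]
    generalize ((n + 1 : ℝ) : ℂ) ^ (-(2 * δ * s)) = P
    generalize ((n + 1 : ℝ) ^ (-(2 * δ))) = w
    have : ∑ j ∈ Finset.range N, quarterBinomCoeff j s *
        (P * (w : ℂ) ^ j * (Real.log (n + 1) : ℝ) + P * (w : ℂ) ^ j * c) =
        P * ((Real.log (n + 1) : ℝ) + c) * ∑ j ∈ Finset.range N, quarterBinomCoeff j s *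
          (w : ℂ) ^ j := by
      rw [Finset.mul_sum]
      exact Finset.sum_congr rfl fun j _ => by ring
    rw [this]
    push_cast
    ring
  · obtain ⟨M, rfl⟩ := Nat.exists_eq_succ_of_ne_zero hN0
    have h1 : ∀ w : ℝ, quarterBinomRem 0 0 w = 1 := fun w => by simp [quarterBinomRem]
    simp only [quarterBinomRem_zero_right hN0, h1, Finset.sum_range_succ', quarterBinomCoeff]
    simp only [zero_div, zero_mul, Finset.sum_const_zero, mul_zero, tsum_zero, zero_add, neg_zero,
      Complex.cpow_zero, mul_one, one_mul, add_zero, Nat.cast_zero, deriv_riemannZeta_zero,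
      riemannZeta_zero]
    push_cast
    rw [Complex.ofReal_log (by positivity)]
    push_cast
    ring

lemma log_sqrt_add_sqrt_bounds {A M x α : ℝ} (hA : 0 < A) (hM : 0 < M) :
    Real.log (2 * √(A ^ 2 * x ^ 2 + M)) ≤
        Real.log (√(A ^ 2 * (x + α) ^ 2 + M) + √(A ^ 2 * (x - α) ^ 2 + M)) ∧
      Real.log (√(A ^ 2 * (x + α) ^ 2 + M) + √(A ^ 2 * (x - α) ^ 2 + M)) ≤
        Real.log (2 * √(A ^ 2 * x ^ 2 + M)) + A ^ 2 * α ^ 2 / (2 * (A ^ 2 * x ^ 2 + M)) := by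
  set p := √(A ^ 2 * (x + α) ^ 2 + M) with hp
  set q := √(A ^ 2 * (x - α) ^ 2 + M) with hq
  set r := √(A ^ 2 * x ^ 2 + M) with hr
  have hp0 : 0 < p := Real.sqrt_pos.2 (by positivity)
  have hq0 : 0 < q := Real.sqrt_pos.2 (by positivity)
  have hr0 : 0 < r := Real.sqrt_pos.2 (by positivity)
  have hp2 : p ^ 2 = A ^ 2 * (x + α) ^ 2 + M := Real.sq_sqrt (by positivity)
  have hq2 : q ^ 2 = A ^ 2 * (x - α) ^ 2 + M := Real.sq_sqrt (by positivity)
  have hr2 : r ^ 2 = A ^ 2 * x ^ 2 + M := Real.sq_sqrt (by positivity)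
  have hpq : r ^ 2 - A ^ 2 * α ^ 2 ≤ p * q := by
    refine le_of_abs_le (abs_le_of_sq_le_sq ?_ (by positivity))
    rw [mul_pow, hp2, hq2, hr2]
    have : 0 ≤ 4 * M * (A ^ 2 * α ^ 2) := by positivity
    linarith
  constructor
  · refine Real.log_le_log (by positivity) ?_
    refine le_of_abs_le (abs_le_of_sq_le_sq ?_ (by positivity))
    nlinarith
  · have h1 : (p + q) ^ 2 ≤ (2 * r) ^ 2 * (1 + A ^ 2 * α ^ 2 / r ^ 2) := by
      have : (2 * r) ^ 2 * (1 + A ^ 2 * α ^ 2 / r ^ 2) = 4 * (r ^ 2 + A ^ 2 * α ^ 2) := by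
        field_simp; ring
      rw [this]
      nlinarith [sq_nonneg (p - q)]
    have h2 := Real.log_le_log (by positivity) h1
    rw [Real.log_mul (by positivity) (by positivity), Real.log_pow, Real.log_pow] at h2
    have h3 : Real.log (1 + A ^ 2 * α ^ 2 / r ^ 2) ≤ A ^ 2 * α ^ 2 / r ^ 2 := by
      have := Real.log_le_sub_one_of_pos (show 0 < 1 + A ^ 2 * α ^ 2 / r ^ 2 by positivity)
      linarith
    rw [← hr2]
    have h4 : A ^ 2 * α ^ 2 / (2 * r ^ 2) = A ^ 2 * α ^ 2 / r ^ 2 / 2 := by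
      field_simp
    rw [h4]
    push_cast at h2
    linarith

lemma log_two_mul_sqrt {A M x : ℝ} (hA : 0 < A) (hM : 0 < M) (hx : 0 < x) :
    Real.log (2 * √(A ^ 2 * x ^ 2 + M)) =
      Real.log x + Real.log (2 * A) + 1 / 2 * Real.log (1 + (√M / A) ^ 2 / x ^ 2) := by
  have h : A ^ 2 * x ^ 2 + M = (A * x) ^ 2 * (1 + (√M / A) ^ 2 / x ^ 2) := by
    rw [div_pow, Real.sq_sqrt hM.le]
    field_simp
  rw [h, Real.sqrt_mul (by positivity), Real.sqrt_sq (by positivity),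
    Real.log_mul two_ne_zero (by positivity), Real.log_mul (by positivity) (by positivity),
    Real.log_sqrt (by positivity), Real.log_mul hA.ne' hx.ne', Real.log_mul two_ne_zero hA.ne']
  ring

lemma hasSum_log_one_add_sq_div {y : ℝ} (hy : 0 < y) :
    HasSum (fun n : ℕ => 1 / 2 * Real.log (1 + y ^ 2 / (n + 1 : ℝ) ^ 2))
      (1 / 2 * Real.log (Real.sinh (π * y) / (π * y))) := by
  refine HasSum.mul_left _ ?_
  rw [hasSum_iff_tendsto_nat_of_nonneg (fun n => Real.log_nonneg (by
    have : 0 ≤ y ^ 2 / (n + 1 : ℝ) ^ 2 := by positivity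
    linarith))]
  have h := Complex.tendsto_euler_sin_prod (y * I)
  have h1 : Tendsto (fun n : ℕ => π * y * ∏ j ∈ Finset.range n, (1 + y ^ 2 / ((j : ℝ) + 1) ^ 2))
      atTop (nhds (Real.sinh (π * y))) := by
    have h2 := h.mul_const (-I)
    have h3 : Complex.sin (π * (y * I)) * -I = ((Real.sinh (π * y) : ℝ) : ℂ) := by
      rw [← mul_assoc, Complex.sin_mul_I]
      push_cast
      linear_combination -Complex.sinh (π * y) * Complex.I_mul_I
    rw [h3] at h2
    rw [← tendsto_ofReal_iff]
    refine h2.congr fun n => ?_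
    have : ∀ j : ℕ, (1 : ℂ) - (y * I) ^ 2 / ((j : ℂ) + 1) ^ 2 = 1 + y ^ 2 / ((j : ℂ) + 1) ^ 2 := by
      intro j
      rw [mul_pow, Complex.I_sq]; ring
    simp only [this]
    push_cast
    linear_combination -(π * y * ∏ j ∈ Finset.range n, (1 + (y : ℂ) ^ 2 / ((j : ℂ) + 1) ^ 2)) *
      Complex.I_mul_I
  have hs : 0 < Real.sinh (π * y) / (π * y) :=
    div_pos (Real.sinh_pos_iff.2 (by positivity)) (by positivity)
  have h4 := ((h1.div_const (π * y)).log hs.ne')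
  refine h4.congr fun n => ?_
  rw [mul_div_cancel_left₀ _ (by positivity), Real.log_prod]
  intro j _
  positivity

lemma tendsto_log_sinh_div_expansion {a : ℝ} (ha : 0 < a) :
    Tendsto (fun μ : ℝ => Real.log (Real.sinh (√(1 / 4 + μ) / (2 * a)) / (√(1 / 4 + μ) / (2 * a)))
      - Real.log (2 * a) + 1 / 2 * Real.log μ - √μ / (2 * a) + Real.log 2) atTop (nhds 0) := by
  have hinv : Tendsto (fun μ : ℝ => (√μ)⁻¹) atTop (nhds 0) :=
    tendsto_inv_atTop_zero.comp Real.tendsto_sqrt_atTop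
  have hY : Tendsto (fun μ : ℝ => √(1 / 4 + μ) / (2 * a)) atTop atTop :=
    (Real.tendsto_sqrt_atTop.comp (tendsto_atTop_add_const_left _ _ tendsto_id)).atTop_div_const
      (by positivity)
  have h1 : Tendsto (fun μ : ℝ => (√(1 / 4 + μ) - √μ) / (2 * a)) atTop (nhds 0) := by
    have : Tendsto (fun μ : ℝ => √(1 / 4 + μ) - √μ) atTop (nhds 0) := by
      refine squeeze_zero' ?_ ?_ hinv
      · filter_upwards with μ
        exact sub_nonneg.2 (Real.sqrt_le_sqrt (by linarith))
      · filter_upwards [eventually_gt_atTop 0] with μ hμ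
        have hm : 0 < √μ := Real.sqrt_pos.2 hμ
        rw [sub_le_iff_le_add, Real.sqrt_le_left (by positivity), add_sq, Real.sq_sqrt hμ.le, mul_assoc,
          inv_mul_cancel₀ hm.ne']
        nlinarith [sq_nonneg (√μ)⁻¹]
    simpa using this.div_const (2 * a)
  have h2 : Tendsto (fun μ : ℝ => Real.log (1 - Real.exp (-(2 * (√(1 / 4 + μ) / (2 * a))))))
      atTop (nhds 0) := by
    have : Tendsto (fun μ : ℝ => 1 - Real.exp (-(2 * (√(1 / 4 + μ) / (2 * a))))) atTop
        (nhds (1 - 0)) :=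
      (Real.tendsto_exp_neg_atTop_nhds_zero.comp (hY.const_mul_atTop two_pos)).const_sub 1
    simpa using this.log (by norm_num)
  have h3 : Tendsto (fun μ : ℝ => 1 / 2 * Real.log (1 + 1 / 4 * μ⁻¹)) atTop (nhds 0) := by
    have : Tendsto (fun μ : ℝ => 1 + 1 / 4 * μ⁻¹) atTop (nhds (1 + 1 / 4 * 0)) :=
      (tendsto_inv_atTop_zero.const_mul _).const_add 1
    simpa using (this.log (by norm_num)).const_mul (1 / 2 : ℝ)
  have h := (h1.add h2).sub h3
  simp only [add_zero, sub_zero] at h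
  refine h.congr' ?_
  filter_upwards [eventually_gt_atTop 0] with μ hμ
  have hs : 0 < √(1 / 4 + μ) := Real.sqrt_pos.2 (by positivity)
  have hY0 : 0 < √(1 / 4 + μ) / (2 * a) := by positivity
  have hlY : Real.log (√(1 / 4 + μ) / (2 * a)) =
      1 / 2 * (Real.log μ + Real.log (1 + 1 / 4 * μ⁻¹)) - Real.log (2 * a) := by
    rw [Real.log_div hs.ne' (by positivity), Real.log_sqrt (by positivity),
      ← Real.log_mul hμ.ne' (by positivity)]
    have : μ * (1 + 1 / 4 * μ⁻¹) = 1 / 4 + μ := by field_simp; ring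
    rw [this]; ring
  have hsub : √(1 / 4 + μ) / (2 * a) - √μ / (2 * a) = (√(1 / 4 + μ) - √μ) / (2 * a) := by ring
  rw [Real.log_div (Real.sinh_pos_iff.2 hY0).ne' hY0.ne', hlY, ← hsub]
  generalize √(1 / 4 + μ) / (2 * a) = Y at *
  have he : Real.exp (-(2 * Y)) < 1 := by
    rw [← Real.exp_zero]; exact Real.exp_lt_exp.2 (by linarith)
  have hsinh : Real.sinh Y = Real.exp Y * (1 - Real.exp (-(2 * Y))) / 2 := by
    rw [Real.sinh_eq, mul_sub, ← Real.exp_add]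
    ring_nf
  have hpos : 0 < Real.exp Y * (1 - Real.exp (-(2 * Y))) :=
    mul_pos (Real.exp_pos Y) (by linarith)
  rw [hsinh, Real.log_div hpos.ne' two_ne_zero,
    Real.log_mul (Real.exp_pos Y).ne' (by linarith), Real.log_exp]
  ring

lemma isConnected_union_strip {x ε : ℝ} (hε : 0 < ε) (hε2 : ε ≤ 1 / 2) :
    IsConnected ({s : ℂ | x < s.re} ∪ {s | -1 / 2 < s.re ∧ 0 < s.im} ∪
      {s | -ε < s.re ∧ s.re < ε}) := by
  have hre : IsLinearMap ℝ Complex.re := Complex.reLm.isLinear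
  have him : IsLinearMap ℝ Complex.im := Complex.imLm.isLinear
  have h1 : IsConnected {s : ℂ | x < s.re} :=
    ⟨⟨(x + 1 : ℝ), by simp⟩, (convex_halfSpace_gt hre x).isPreconnected⟩
  have h2 : IsConnected {s : ℂ | -1 / 2 < s.re ∧ 0 < s.im} :=
    ⟨⟨I, by norm_num⟩,
      ((convex_halfSpace_gt hre _).inter (convex_halfSpace_gt him 0)).isPreconnected⟩
  have h3 : IsConnected {s : ℂ | -ε < s.re ∧ s.re < ε} :=
    ⟨⟨0, by simpa using hε⟩,
      ((convex_halfSpace_gt hre _).inter (convex_halfSpace_lt hre _)).isPreconnected⟩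
  refine IsConnected.union ⟨I, Or.inr (by norm_num), by simpa using hε⟩
    (IsConnected.union ⟨⟨|x| + 1, 1⟩, ?_, ?_, ?_⟩ h1 h2) h3
  · show x < |x| + 1
    linarith [le_abs_self x]
  · show -1 / 2 < |x| + 1
    linarith [abs_nonneg x]
  · show (0 : ℝ) < 1
    norm_num

/-- The logarithm `log (√(A²(x+α)²+M) + √(A²(x-α)²+M))` with its leading part
`log x + log (2A)` removed. -/
noncomputable def logSqrtDefect (A α M x : ℝ) : ℝ :=
  Real.log (√(A ^ 2 * (x + α) ^ 2 + M) + √(A ^ 2 * (x - α) ^ 2 + M)) -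
    Real.log x - Real.log (2 * A)

lemma logSqrtDefect_bounds {A M x α : ℝ} (hA : 0 < A) (hM : 0 < M) (hx : 0 < x) :
    0 ≤ logSqrtDefect A α M x - 1 / 2 * Real.log (1 + (√M / A) ^ 2 / x ^ 2) ∧
      logSqrtDefect A α M x - 1 / 2 * Real.log (1 + (√M / A) ^ 2 / x ^ 2) ≤
        A ^ 2 * α ^ 2 / (2 * (A ^ 2 * x ^ 2 + M)) := by
  obtain ⟨h1, h2⟩ := log_sqrt_add_sqrt_bounds (x := x) (α := α) hA hM
  rw [log_two_mul_sqrt hA hM hx] at h1 h2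
  unfold logSqrtDefect
  constructor <;> linarith

lemma sq_mul_div_le {A M x α : ℝ} (hA : 0 < A) (hM : 0 < M) (hx : 0 < x) :
    A ^ 2 * α ^ 2 / (2 * (A ^ 2 * x ^ 2 + M)) ≤ α ^ 2 / 2 * x ^ (-2 : ℝ) := by
  have : α ^ 2 / 2 * x ^ (-2 : ℝ) = A ^ 2 * α ^ 2 / (2 * (A ^ 2 * x ^ 2)) := by
    rw [Real.rpow_neg hx.le, Real.rpow_two]
    field_simp
  rw [this]
  gcongr
  linarith

lemma abs_logSqrtDefect_le {A M x α : ℝ} (hA : 0 < A) (hM : 0 < M) (hx : 0 < x) :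
    |logSqrtDefect A α M x| ≤ (α ^ 2 / 2 + (√M / A) ^ 2 / 2) * x ^ (-2 : ℝ) := by
  obtain ⟨h1, h2⟩ := logSqrtDefect_bounds (α := α) hA hM hx
  have h3 := sq_mul_div_le (α := α) hA hM hx
  have h0 : 0 ≤ (√M / A) ^ 2 / x ^ 2 := by positivity
  have h4 : 0 ≤ Real.log (1 + (√M / A) ^ 2 / x ^ 2) := Real.log_nonneg (by linarith)
  have h5 : Real.log (1 + (√M / A) ^ 2 / x ^ 2) ≤ (√M / A) ^ 2 / x ^ 2 := by
    have := Real.log_le_sub_one_of_pos (show 0 < 1 + (√M / A) ^ 2 / x ^ 2 by positivity)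
    linarith
  have h6 : (√M / A) ^ 2 / 2 * x ^ (-2 : ℝ) = 1 / 2 * ((√M / A) ^ 2 / x ^ 2) := by
    rw [Real.rpow_neg hx.le, Real.rpow_two]
    field_simp
  rw [abs_of_nonneg (by linarith), add_mul, h6]
  linarith

lemma summable_add_one_rpow_neg_two : Summable fun n : ℕ => (n + 1 : ℝ) ^ (-2 : ℝ) := by
  have := (Real.summable_nat_rpow (p := -2)).2 (by norm_num)
  simpa using (summable_nat_add_iff 1).2 this

lemma tendsto_tsum_logSqrtDefect_sub {A : ℝ} (hA : 0 < A) (α : ℝ) :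
    Tendsto (fun μ : ℝ => ∑' n : ℕ, (logSqrtDefect A α (1 / 4 + μ) (n + 1) -
      1 / 2 * Real.log (1 + (√(1 / 4 + μ) / A) ^ 2 / (n + 1 : ℝ) ^ 2))) atTop (nhds 0) := by
  have h0 : (0 : ℝ) = ∑' _ : ℕ, (0 : ℝ) := by simp
  rw [h0]
  refine tendsto_tsum_of_dominated_convergence
    (summable_add_one_rpow_neg_two.mul_left (α ^ 2 / 2)) (fun n => ?_) ?_
  · have hn : (0 : ℝ) < n + 1 := by positivity
    have ht : Tendsto (fun μ : ℝ => A ^ 2 * α ^ 2 / (2 * (A ^ 2 * (n + 1 : ℝ) ^ 2 + (1 / 4 + μ))))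
        atTop (nhds 0) := by
      refine Tendsto.div_atTop tendsto_const_nhds ?_
      exact (tendsto_atTop_add_const_left _ _
        (tendsto_atTop_add_const_left _ _ tendsto_id)).const_mul_atTop two_pos
    refine squeeze_zero' ?_ ?_ ht
    · filter_upwards [eventually_gt_atTop 0] with μ hμ
      exact (logSqrtDefect_bounds hA (by positivity) hn).1
    · filter_upwards [eventually_gt_atTop 0] with μ hμ
      exact (logSqrtDefect_bounds hA (by positivity) hn).2
  · filter_upwards [eventually_gt_atTop 0] with μ hμ n
    have hn : (0 : ℝ) < n + 1 := by positivity
    obtain ⟨h1, h2⟩ := logSqrtDefect_bounds (α := α) hA (show 0 < 1 / 4 + μ by positivity) hn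
    rw [Real.norm_eq_abs, abs_of_nonneg h1]
    exact h2.trans (sq_mul_div_le hA (by positivity) hn)

lemma tendsto_tsum_logSqrtDefect {a : ℝ} (ha : 0 < a) (α : ℝ) :
    Tendsto (fun μ : ℝ => -(Real.log (2 * π) - Real.log (2 * (2 * π * a)) +
        2 * ∑' n : ℕ, logSqrtDefect (2 * π * a) α (1 / 4 + μ) (n + 1)) -
      ((1 / 2) * Real.log μ - √μ / (2 * a) + Real.log 2)) atTop (nhds 0) := by
  have hA : 0 < 2 * π * a := by positivity
  have h := ((tendsto_tsum_logSqrtDefect_sub hA α).const_mul 2).add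
    (tendsto_log_sinh_div_expansion ha)
  have h' := h.neg
  simp only [mul_zero, add_zero, neg_zero] at h'
  refine h'.congr' ?_
  filter_upwards [eventually_gt_atTop 0] with μ hμ
  have hM : 0 < 1 / 4 + μ := by positivity
  have hy : 0 < √(1 / 4 + μ) / (2 * π * a) := div_pos (Real.sqrt_pos.2 hM) hA
  have hs := hasSum_log_one_add_sq_div hy
  have hd : Summable fun n : ℕ => logSqrtDefect (2 * π * a) α (1 / 4 + μ) (n + 1) :=
    Summable.of_norm_bounded (summable_add_one_rpow_neg_two.mul_left _)
      fun n => abs_logSqrtDefect_le hA hM (by positivity)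
  have hpi : π * (√(1 / 4 + μ) / (2 * π * a)) = √(1 / 4 + μ) / (2 * a) := by
    field_simp
  have hlog : Real.log (2 * (2 * π * a)) = Real.log (2 * π) + Real.log (2 * a) := by
    rw [← Real.log_mul (by positivity) (by positivity)]
    ring_nf
  rw [hd.tsum_sub hs.summable, hs.tsum_eq, hpi, hlog]
  ring

lemma hasSum_int_ne_zero {f : ℤ → ℂ} {g : ℕ → ℂ} {S : ℂ} (hpos : ∀ n : ℕ, f (n + 1) = g n)
    (hneg : ∀ n : ℕ, f (-(n + 1)) = g n) (hg : HasSum g S) :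
    HasSum (fun k : {k : ℤ // k ≠ 0} => f k) (2 * S) := by
  refine (hasSum_subtype_iff_indicator (s := {k : ℤ | k ≠ 0}) (f := f)).2 ?_
  have hpos' : ∀ n : ℕ, Set.indicator {k : ℤ | k ≠ 0} f (n + 1) = g n := fun n => by
    rw [Set.indicator_of_mem (show ((n : ℤ) + 1) ≠ 0 by omega), hpos]
  have hneg' : ∀ n : ℕ, Set.indicator {k : ℤ | k ≠ 0} f (-(n + 1)) = g n := fun n => by
    rw [Set.indicator_of_mem (show -((n : ℤ) + 1) ≠ 0 by omega), hneg]
  have h := HasSum.of_add_one_of_neg_add_one (f := Set.indicator {k : ℤ | k ≠ 0} f)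
    (by simpa only [hpos'] using hg) (by simpa only [hneg'] using hg)
  rw [Set.indicator_of_notMem (by simp), add_zero, ← two_mul] at h
  exact h

lemma hasSum_zeta6Term {a α δ μ : ℝ} {s G : ℂ}
    (h : HasSum (fun n : ℕ => (((n + 1 : ℝ) ^ (2 * δ) - 1 / 4 : ℝ) : ℂ) ^ (-s) *
      ((Real.log (n + 1) + Real.log (2 * (2 * π * a)) +
        logSqrtDefect (2 * π * a) α (1 / 4 + μ) (n + 1) : ℝ) : ℂ)) G) :
    HasSum (fun k : {k : ℤ // k ≠ 0} => zeta6Term a α δ μ k s)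
      (-(Complex.sin (π * s) / π) * ((4 * μ + 1 : ℝ) : ℂ) ^ (-s) * (2 * G)) := by
  have hlog : ∀ n : ℕ, Real.log (n + 1) + Real.log (2 * (2 * π * a)) +
      logSqrtDefect (2 * π * a) α (1 / 4 + μ) (n + 1) =
      Real.log (√(4 * π ^ 2 * ((n + 1 : ℝ) + α) ^ 2 * a ^ 2 + 1 / 4 + μ) +
        √(4 * π ^ 2 * ((n + 1 : ℝ) - α) ^ 2 * a ^ 2 + 1 / 4 + μ)) := by
    intro n
    rw [logSqrtDefect]
    ring_nf
  unfold zeta6Term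
  simp only [mul_assoc _ (_ ^ (-s)) (Complex.ofReal (Real.log _))]
  refine HasSum.mul_left _ (hasSum_int_ne_zero (f := fun k : ℤ =>
    ((|(k : ℝ)| ^ (2 * δ) - 1 / 4 : ℝ) : ℂ) ^ (-s) *
    ((Real.log (Real.sqrt (4 * π ^ 2 * ((k : ℝ) + α) ^ 2 * a ^ 2 + 1 / 4 + μ) +
        Real.sqrt (4 * π ^ 2 * ((k : ℝ) - α) ^ 2 * a ^ 2 + 1 / 4 + μ)) : ℝ) : ℂ)) ?_ ?_ h)
  · intro n
    have hn : (0 : ℝ) < n + 1 := by positivity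
    simp only [Int.cast_add, Int.cast_natCast, Int.cast_one, abs_of_pos hn, hlog n]
  · intro n
    have hn : (0 : ℝ) < n + 1 := by positivity
    have h1 : (-(n + 1 : ℝ) + α) ^ 2 = ((n + 1 : ℝ) - α) ^ 2 := by ring
    have h2 : (-(n + 1 : ℝ) - α) ^ 2 = ((n + 1 : ℝ) + α) ^ 2 := by ring
    simp only [Int.cast_neg, Int.cast_add, Int.cast_natCast, Int.cast_one, abs_neg, abs_of_pos hn,
      h1, h2, hlog n]
    rw [add_comm (√_)]

/-- The series defining `ζ⁶_μ` converges for `Re s > 1/(2δ)`; for all `μ` large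
enough, `ζ⁶_μ` extends holomorphically to a connected open set containing `0`
and the half-plane `Re s > 1/(2δ)`, with value `0` at `0`, and the derivative of
the extension at `0` is `(1/2) log μ - √μ/(2a) + log 2 + o(1)` as `μ → +∞`. -/
theorem stmt19 (a α δ : ℝ) (ha : 0 < a) (hα0 : 0 ≤ α) (hα1 : α < 1)
    (hδ0 : 0 < δ) (hδ1 : δ < 1) (hδint : ∀ n : ℤ, 1 / (2 * δ) ≠ (n : ℝ)) :
    (∀ μ : ℝ, 0 ≤ μ → ∀ s : ℂ, 1 / (2 * δ) < s.re →
      Summable (fun k : {k : ℤ // k ≠ 0} => zeta6Term a α δ μ k s)) ∧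
    ∃ μ₀ : ℝ, 0 ≤ μ₀ ∧ ∃ g : ℝ → ℂ → ℂ,
      (∀ μ : ℝ, μ₀ ≤ μ → ∃ U : Set ℂ, IsOpen U ∧ IsConnected U ∧ (0 : ℂ) ∈ U ∧
        {s : ℂ | 1 / (2 * δ) < s.re} ⊆ U ∧
        DifferentiableOn ℂ (g μ) U ∧
        (∀ s : ℂ, 1 / (2 * δ) < s.re →
          g μ s = ∑' k : {k : ℤ // k ≠ 0}, zeta6Term a α δ μ k s) ∧
        g μ 0 = 0) ∧
      Tendsto (fun μ : ℝ => deriv (g μ) 0 -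
          (((1 / 2) * Real.log μ - Real.sqrt μ / (2 * a) + Real.log 2 : ℝ) : ℂ))
        atTop (nhds 0) := by
  have hA : 0 < 2 * π * a := by positivity
  have key : ∀ μ : ℝ, ∃ G : ℂ → ℂ, 0 ≤ μ →
      (∀ s : ℂ, -1 / 2 < s.re → (∀ j : ℕ, 2 * δ * (s + j) ≠ 1) → DifferentiableAt ℂ G s) ∧
      (∀ s : ℂ, 1 / (2 * δ) < s.re → HasSum (fun k : {k : ℤ // k ≠ 0} => zeta6Term a α δ μ k s)
        (-(Complex.sin (π * s) / π) * ((4 * μ + 1 : ℝ) : ℂ) ^ (-s) * (2 * G s))) ∧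
      G 0 = ((Real.log (2 * π) / 2 - Real.log (2 * (2 * π * a)) / 2 +
        ∑' n : ℕ, logSqrtDefect (2 * π * a) α (1 / 4 + μ) (n + 1) : ℝ) : ℂ) := by
    intro μ
    by_cases hμ : 0 ≤ μ
    · obtain ⟨G, h1, h2, h3⟩ := exists_continuation hδ0 hδ1 (Real.log (2 * (2 * π * a)))
        (e := fun n : ℕ => logSqrtDefect (2 * π * a) α (1 / 4 + μ) (n + 1))
        fun n => abs_logSqrtDefect_le hA (by positivity) (by positivity)
      exact ⟨G, fun _ => ⟨h1, fun s hs => hasSum_zeta6Term (h2 s hs), h3⟩⟩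
    · exact ⟨0, fun h => absurd h hμ⟩
  choose G hG using key
  have hpole : ∀ j : ℕ, 2 * (δ : ℂ) * ((0 : ℂ) + j) ≠ 1 := by
    intro j h
    have h' : 2 * δ * j = 1 := by
      have := congrArg Complex.re h
      simpa using this
    refine hδint j ?_
    rw [div_eq_iff (by positivity)]
    push_cast
    linarith
  have hdiff : ∀ μ : ℝ, 0 ≤ μ → ∀ s : ℂ, DifferentiableAt ℂ (G μ) s → DifferentiableAt ℂ
      (fun s => -(Complex.sin (π * s) / π) * ((4 * μ + 1 : ℝ) : ℂ) ^ (-s) * (2 * G μ s)) s := by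
    intro μ hμ s hs
    have h4 : ((4 * μ + 1 : ℝ) : ℂ) ≠ 0 := by
      rw [Complex.ofReal_ne_zero]; positivity
    have h5 : DifferentiableAt ℂ (fun s : ℂ => ((4 * μ + 1 : ℝ) : ℂ) ^ (-s)) s :=
      DifferentiableAt.const_cpow (by fun_prop) (Or.inl h4)
    fun_prop
  refine ⟨fun μ hμ s hs => ((hG μ hμ).2.1 s hs).summable, 0, le_rfl,
    fun μ s => -(Complex.sin (π * s) / π) * ((4 * μ + 1 : ℝ) : ℂ) ^ (-s) * (2 * G μ s), ?_, ?_⟩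
  · intro μ hμ
    obtain ⟨h1, h2, -⟩ := hG μ hμ
    obtain ⟨ε, hε0, hε2, hε⟩ : ∃ ε : ℝ, 0 < ε ∧ ε ≤ 1 / 2 ∧
        ∀ j : ℕ, ε ≤ |1 / (2 * δ) - j| := by
      set x := 1 / (2 * δ)
      have hf1 : (⌊x⌋ : ℝ) < x := lt_of_le_of_ne (Int.floor_le x) (hδint _).symm
      have hf2 := Int.lt_floor_add_one x
      refine ⟨min (x - ⌊x⌋) (⌊x⌋ + 1 - x), lt_min (by linarith) (by linarith), ?_, fun j => ?_⟩
      · rcases le_total (x - ⌊x⌋) (⌊x⌋ + 1 - x) with h | h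
        · rw [min_eq_left h]; linarith
        · rw [min_eq_right h]; linarith
      · rcases le_or_gt (j : ℤ) ⌊x⌋ with h | h
        · have : (j : ℝ) ≤ ⌊x⌋ := by exact_mod_cast h
          exact (min_le_left _ _).trans (le_trans (by linarith) (le_abs_self _))
        · have : (⌊x⌋ : ℝ) + 1 ≤ j := by exact_mod_cast h
          exact (min_le_right _ _).trans (le_trans (by linarith) (neg_le_abs _))
    refine ⟨_, ?_, isConnected_union_strip (x := 1 / (2 * δ)) hε0 hε2, ?_, ?_, ?_,
      fun s hs => (h2 s hs).tsum_eq.symm, by simp⟩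
    · exact ((isOpen_lt continuous_const Complex.continuous_re).union
        ((isOpen_lt continuous_const Complex.continuous_re).inter
          (isOpen_lt continuous_const Complex.continuous_im))).union
        ((isOpen_lt continuous_const Complex.continuous_re).inter
          (isOpen_lt Complex.continuous_re continuous_const))
    · exact Or.inr (by simpa using hε0)
    · exact fun s hs => Or.inl (Or.inl hs)
    · intro s hs
      refine (hdiff μ hμ s (h1 s ?_ fun j hj => ?_)).differentiableWithinAt
      · rcases hs with (hs | hs) | hs
        · have : 0 < 1 / (2 * δ) := by positivity
          have hs' : 1 / (2 * δ) < s.re := hs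
          linarith
        · exact hs.1
        · linarith [hs.1]
      · have hre : 2 * δ * (s.re + j) = 1 := by simpa using congrArg Complex.re hj
        have him : 2 * δ * s.im = 0 := by simpa using congrArg Complex.im hj
        have hre' : s.re = 1 / (2 * δ) - j := by
          field_simp
          linarith
        rcases hs with (hs | hs) | hs
        · have hs' : 1 / (2 * δ) < s.re := hs
          linarith [j.cast_nonneg (α := ℝ)]
        · have : 0 < 2 * δ * s.im := mul_pos (by positivity) hs.2
          linarith
        · have := hε j
          rw [← hre'] at this
          exact absurd (abs_lt.2 hs) (not_lt.2 this)
  · have ht := (Complex.continuous_ofReal.tendsto 0).comp (tendsto_tsum_logSqrtDefect ha α)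
    rw [Complex.ofReal_zero] at ht
    refine ht.congr' ?_
    filter_upwards [eventually_ge_atTop 0] with μ hμ
    obtain ⟨h1, -, h3⟩ := hG μ hμ
    have h4 : ((4 * μ + 1 : ℝ) : ℂ) ≠ 0 := by
      rw [Complex.ofReal_ne_zero]; positivity
    have h5 : DifferentiableAt ℂ (fun s : ℂ => ((4 * μ + 1 : ℝ) : ℂ) ^ (-s) * (2 * G μ s)) 0 :=
      (DifferentiableAt.const_cpow (by fun_prop) (Or.inl h4)).mul
        ((h1 0 (by norm_num) hpole).const_mul _)
    have h6 : HasDerivAt (fun s : ℂ => -(Complex.sin (π * s) / π)) (-1) 0 := by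
      have := ((Complex.hasDerivAt_sin (π * 0)).comp (0 : ℂ)
        ((hasDerivAt_id (0 : ℂ)).const_mul (π : ℂ))).div_const (π : ℂ)
      have hpi : (π : ℂ) ≠ 0 := by exact_mod_cast Real.pi_ne_zero
      simpa [hpi] using! this.fun_neg
    have h7 := (h6.mul h5.hasDerivAt).deriv
    have h8 : deriv (fun s => -(Complex.sin (π * s) / π) * ((4 * μ + 1 : ℝ) : ℂ) ^ (-s) *
        (2 * G μ s)) 0 = -(2 * G μ 0) := by
      simp only [mul_assoc]
      refine h7.trans ?_
      simp
    rw [h8, h3]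
    simp only [Function.comp]
    push_cast
    ring
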